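/- Let Λ be an artin algebra, let μ₀ be a central GR measure for Λ, and let μ₀ ≺ μ₁ ≺ μ₂ ≺ ⋯ be a sequence of GR measures such that μ_{i+1} is a direct successor of μ_i for every i ≥ 0. If |μ₀| ≤ |μ_i| for all i ≥ 0 (where |I| denotes the maximal element of I), then for every i ≥ 1 the measure μ_i starts with μ₀. -/

import Mathlib

/-- The Gabriel–Roiter total order on sets of natural numbers: `I ≺ J` iff
`I ≠ J` and the least element of the symmetric difference belongs to `J`.
(All sets occurring as Gabriel–Roiter measures consist of positive integers.) -/
def GRlt (I J : Set ℕ) : Prop :=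
  I ≠ J ∧ ∃ m ∈ (I \ J) ∪ (J \ I), (∀ k ∈ (I \ J) ∪ (J \ I), m ≤ k) ∧ m ∈ J

/-- `I ≼ J` iff `I = J` or `I ≺ J`. -/
def GRle (I J : Set ℕ) : Prop := I = J ∨ GRlt I J

/-- A module is indecomposable if it is nonzero and is not the internal direct
sum of two nonzero submodules. -/
def IsIndecomposableModule (Λ : Type*) [Ring Λ] (M : Type*) [AddCommGroup M]
    [Module Λ M] : Prop :=
  (⊤ : Submodule Λ M) ≠ ⊥ ∧
    ¬ ∃ A B : Submodule Λ M, A ≠ ⊥ ∧ B ≠ ⊥ ∧ IsCompl A B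

open Classical in
/-- The (composition series) length `|M|` of a finite length module `M`,
defined via a composition series from `⊥` to `⊤` (any two such have the same
length by the Jordan–Hölder theorem); it is `0` if no such series exists. -/
noncomputable def mlen (Λ : Type*) [Ring Λ] (M : Type*) [AddCommGroup M]
    [Module Λ M] : ℕ :=
  if h : ∃ s : CompositionSeries (Submodule Λ M), s.head = ⊥ ∧ s.last = ⊤ then
    h.choose.length
  else 0

/-- The collection of subsets of `ℕ` of the form `{|M₁|, …, |M_t|}` where
`M₁ ⊂ M₂ ⊂ ⋯ ⊂ M_t` ranges over (finite, nonempty) chains of indecomposable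
submodules of `M`. -/
def grChainSets (Λ : Type*) [Ring Λ] (M : Type*) [AddCommGroup M]
    [Module Λ M] : Set (Set ℕ) :=
  { S | ∃ (t : ℕ) (c : Fin (t + 1) → Submodule Λ M), StrictMono c ∧
      (∀ i, IsIndecomposableModule Λ (c i)) ∧
      S = Set.range fun i => mlen Λ (c i) }

open Classical in
/-- The Gabriel–Roiter measure `μ(M)`: the maximum, with respect to the total
order `≺`, of the sets of lengths of chains of indecomposable submodules of
`M` (and `∅` if this maximum does not exist, e.g. for `M = 0`). -/
noncomputable def grMeasure (Λ : Type*) [Ring Λ] (M : Type*) [AddCommGroup M]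
    [Module Λ M] : Set ℕ :=
  if h : ∃ S, S ∈ grChainSets Λ M ∧ ∀ S' ∈ grChainSets Λ M, GRle S' S then
    h.choose
  else ∅
universe u

/-- A bundled `Λ`-module (in the same universe as `Λ`). -/
structure BundledMod (Λ : Type u) [Ring Λ] : Type (u + 1) where
  carrier : Type u
  [isAddCommGroup : AddCommGroup carrier]
  [isModule : Module Λ carrier]

attribute [instance] BundledMod.isAddCommGroup BundledMod.isModule

/-- `Λ` has finite representation type: there are only finitely many
isomorphism classes of indecomposable finitely generated `Λ`-modules, i.e.
there is a finite list of modules such that every indecomposable finitely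
generated `Λ`-module is isomorphic to one of them. -/
def HasFiniteRepType (Λ : Type u) [Ring Λ] : Prop :=
  ∃ (n : ℕ) (rep : Fin n → BundledMod Λ),
    ∀ (M : Type u) (_ : AddCommGroup M) (_ : Module Λ M),
      Module.Finite Λ M → IsIndecomposableModule Λ M →
        ∃ i, Nonempty (M ≃ₗ[Λ] (rep i).carrier)

/-- `I` is a Gabriel–Roiter measure for `Λ` if `I = μ(M)` for some
indecomposable finitely generated `Λ`-module `M`. -/
def IsGRMeasureOf (Λ : Type u) [Ring Λ] (I : Set ℕ) : Prop :=
  ∃ (M : Type u) (_ : AddCommGroup M) (_ : Module Λ M),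
    Module.Finite Λ M ∧ IsIndecomposableModule Λ M ∧ grMeasure Λ M = I

/-- `J` is a direct successor of `I` (and `I` a direct predecessor of `J`):
both are GR measures for `Λ`, `I ≺ J`, and no GR measure lies strictly
between them. -/
def IsDirectSuccessor (Λ : Type u) [Ring Λ] (I J : Set ℕ) : Prop :=
  IsGRMeasureOf Λ I ∧ IsGRMeasureOf Λ J ∧ GRlt I J ∧
    ¬ ∃ K, IsGRMeasureOf Λ K ∧ GRlt I K ∧ GRlt K J

/-- A GR segment: a nonempty set of GR measures closed under taking direct
successors and direct predecessors. -/
def IsGRSegment (Λ : Type u) [Ring Λ] (S : Set (Set ℕ)) : Prop :=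
  S.Nonempty ∧ (∀ I ∈ S, IsGRMeasureOf Λ I) ∧
    ∀ I ∈ S, ∀ J, (IsDirectSuccessor Λ I J ∨ IsDirectSuccessor Λ J I) → J ∈ S

/-- `I ≪ J` iff `I ⊊ J` and every element of `I` is smaller than every element
of `J \ I`. -/
def GRll (I J : Set ℕ) : Prop :=
  I ⊂ J ∧ ∀ a ∈ I, ∀ b ∈ J \ I, a < b

/-- `GRstartsWith J I` means "`J` starts with `I`", i.e. `I = J` or `I ≪ J`. -/
def GRstartsWith (J I : Set ℕ) : Prop :=
  I = J ∨ GRll I J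

theorem GRlt_iff {I J : Set ℕ} :
    GRlt I J ↔ ∃ m, m ∈ J ∧ m ∉ I ∧ ∀ k < m, k ∈ I ↔ k ∈ J := by
  constructor
  · rintro ⟨-, m, hm, hmin, hmJ⟩
    refine ⟨m, hmJ, ?_, fun k hk => ?_⟩
    · rcases hm with hm | hm
      · exact absurd hmJ hm.2
      · exact hm.2
    · by_contra hne
      have hle := hmin k (by simp only [Set.mem_union, Set.mem_sdiff]; tauto)
      omega
  · rintro ⟨m, hmJ, hmI, h⟩
    refine ⟨fun h' => hmI (h' ▸ hmJ), m, Or.inr ⟨hmJ, hmI⟩, fun k hk => ?_, hmJ⟩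
    by_contra hlt
    have hiff := h k (by omega)
    simp only [Set.mem_union, Set.mem_sdiff] at hk
    tauto

theorem GRlt.asymm {I J : Set ℕ} (h : GRlt I J) : ¬ GRlt J I := by
  rw [GRlt_iff] at *
  obtain ⟨m, hmJ, hmI, hm⟩ := h
  rintro ⟨n, hnI, hnJ, hn⟩
  rcases lt_trichotomy m n with h | rfl | h
  · exact hmI ((hn m h).1 hmJ)
  · exact hmI hnI
  · exact hnJ ((hm n h).1 hnI)

theorem GRlt.trans {I J K : Set ℕ} (h : GRlt I J) (h' : GRlt J K) : GRlt I K := by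
  rw [GRlt_iff] at *
  obtain ⟨m, hmJ, hmI, hm⟩ := h
  obtain ⟨n, hnK, hnJ, hn⟩ := h'
  rcases lt_trichotomy m n with h | rfl | h
  · exact ⟨m, (hn m h).1 hmJ, hmI, fun k hk => (hm k hk).trans (hn k (hk.trans h))⟩
  · exact absurd hmJ hnJ
  · exact ⟨n, hnK, fun hnI => hnJ ((hm n h).1 hnI),
      fun k hk => (hm k (hk.trans h)).trans (hn k hk)⟩

theorem GRle.antisymm {I J : Set ℕ} (h : GRle I J) (h' : GRle J I) : I = J := by
  rcases h with h | h
  · exact h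
  · rcases h' with h' | h'
    · exact h'.symm
    · exact absurd h' h.asymm

theorem GRlt_or_GRle (I J : Set ℕ) : GRlt I J ∨ GRle J I := by
  classical
  by_cases hIJ : I = J
  · exact Or.inr (Or.inl hIJ.symm)
  have hex : ∃ k, ¬ (k ∈ I ↔ k ∈ J) := by
    by_contra! h
    exact hIJ (Set.ext h)
  have hm := Nat.find_spec hex
  have hmin : ∀ k < Nat.find hex, k ∈ I ↔ k ∈ J := fun k hk => not_not.1 (Nat.find_min hex hk)
  by_cases hJ : Nat.find hex ∈ J
  · exact Or.inl (GRlt_iff.2 ⟨_, hJ, by tauto, hmin⟩)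
  · exact Or.inr (Or.inr (GRlt_iff.2 ⟨_, by tauto, hJ, fun k hk => (hmin k hk).symm⟩))

theorem IsIndecomposableModule.of_linearEquiv {Λ M N : Type*} [Ring Λ] [AddCommGroup M]
    [Module Λ M] [AddCommGroup N] [Module Λ N] (e : M ≃ₗ[Λ] N)
    (h : IsIndecomposableModule Λ M) : IsIndecomposableModule Λ N := by
  have f : Submodule Λ N ≃o Submodule Λ M := (Submodule.orderIsoMapComap e).symm
  refine ⟨fun h' => h.1 ?_, ?_⟩
  · rw [← map_top f, h', map_bot]
  · rintro ⟨A, B, hA, hB, hAB⟩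
    exact h.2 ⟨f A, f B, by simpa using hA, by simpa using hB, f.isCompl hAB⟩

section Length

variable {Λ M N : Type*} [Ring Λ] [AddCommGroup M] [Module Λ M] [AddCommGroup N] [Module Λ N]
  [IsNoetherian Λ M] [IsArtinian Λ M] [IsNoetherian Λ N] [IsArtinian Λ N]

theorem coe_mlen : (mlen Λ M : ℕ∞) = Module.length Λ M := by
  have h := exists_compositionSeries_of_isNoetherian_isArtinian Λ M
  rw [mlen, dif_pos h]
  exact Module.length_compositionSeries _ h.choose_spec.1 h.choose_spec.2

theorem mlen_congr (e : M ≃ₗ[Λ] N) : mlen Λ M = mlen Λ N := by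
  have h := e.length_eq
  rw [← coe_mlen, ← coe_mlen] at h
  exact_mod_cast h

theorem mlen_submodule_le (A : Submodule Λ M) : mlen Λ A ≤ mlen Λ M := by
  have h := Module.length_le_of_injective A.subtype A.injective_subtype
  rw [← coe_mlen, ← coe_mlen] at h
  exact_mod_cast h

theorem mlen_submodule_strictMono : StrictMono fun A : Submodule Λ M => mlen Λ A := by
  intro A B hAB
  have h := Submodule.height_strictMono hAB
  rw [← Module.length_submodule, ← Module.length_submodule, ← coe_mlen, ← coe_mlen] at h
  exact_mod_cast h

theorem image_mem_grChainSets_of_submodule {A : Submodule Λ M} {S : Set ℕ}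
    (hS : S ∈ grChainSets Λ A) : S ∈ grChainSets Λ M := by
  obtain ⟨t, c, hc, hind, rfl⟩ := hS
  refine ⟨t, fun i => (c i).map A.subtype,
    (Submodule.map_strictMono_of_injective A.injective_subtype).comp hc,
    fun i => (hind i).of_linearEquiv (A.equivSubtypeMap (c i)), ?_⟩
  congr 1
  funext i
  exact mlen_congr (A.equivSubtypeMap (c i))

theorem le_mlen_of_mem_grChainSets {S : Set ℕ} (hS : S ∈ grChainSets Λ M) {k : ℕ}
    (hk : k ∈ S) : k ≤ mlen Λ M := by
  obtain ⟨t, c, -, -, rfl⟩ := hS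
  obtain ⟨i, rfl⟩ := hk
  exact mlen_submodule_le _

/-- A greatest chain set of `M`, truncated at one of its elements, is the Gabriel–Roiter measure of
an indecomposable submodule of `M`. -/
theorem exists_submodule_grMeasure_eq_inter_Iic {S : Set ℕ} (hS : S ∈ grChainSets Λ M)
    (hmax : ∀ S' ∈ grChainSets Λ M, GRle S' S) {m : ℕ} (hm : m ∈ S) :
    ∃ A : Submodule Λ M, IsIndecomposableModule Λ A ∧ grMeasure Λ A = S ∩ Set.Iic m := by
  obtain ⟨t, c, hc, hind, hSc⟩ := id hS
  obtain ⟨j, hj⟩ : ∃ j, mlen Λ (c j) = m := by simpa [hSc] using hm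
  have hlen : StrictMono fun i => mlen Λ (c i) := mlen_submodule_strictMono.comp hc
  have hle : ∀ i : Fin (j + 1), Fin.castLE (by omega) i ≤ j := fun i =>
    Fin.le_def.2 (Nat.lt_succ_iff.1 i.2)
  let e : ∀ i : Fin (j + 1), (c (Fin.castLE (by omega) i)) ≃ₗ[Λ]
      ((c (Fin.castLE (by omega) i)).comap (c j).subtype) := fun i =>
    (Submodule.comapSubtypeEquivOfLe (hc.monotone (hle i))).symm
  have hmem : S ∩ Set.Iic m ∈ grChainSets Λ (c j) := by
    refine ⟨j, fun i => (c (Fin.castLE (by omega) i)).comap (c j).subtype, ?_,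
      fun i => (hind _).of_linearEquiv (e i), ?_⟩
    · intro a b hab
      have hlt : c (Fin.castLE (by omega) a) < c (Fin.castLE (by omega) b) := hc hab
      refine lt_of_le_of_ne (Submodule.comap_mono hlt.le) fun heq => hlt.ne ?_
      have := congrArg (Submodule.map (c j).subtype) heq
      simpa [Submodule.map_comap_subtype, inf_eq_right.2 (hc.monotone (hle _))] using this
    · have hfun : (fun i : Fin (j + 1) =>
          mlen Λ ((c (Fin.castLE (by omega) i)).comap (c j).subtype)) =
          fun i => mlen Λ (c (Fin.castLE (by omega) i)) :=
        funext fun i => (mlen_congr (e i)).symm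
      rw [hfun]
      ext k
      simp only [hSc, Set.mem_inter_iff, Set.mem_range, Set.mem_Iic]
      constructor
      · rintro ⟨⟨i, rfl⟩, hi⟩
        have hij : i ≤ j := hlen.le_iff_le.1 (hi.trans hj.ge)
        exact ⟨⟨i, Nat.lt_succ_of_le hij⟩, rfl⟩
      · rintro ⟨i, rfl⟩
        exact ⟨⟨_, rfl⟩, (hlen.monotone (hle i)).trans hj.le⟩
  have hmax' : ∀ S' ∈ grChainSets Λ (c j), GRle S' (S ∩ Set.Iic m) := by
    intro S' hS'
    rcases GRlt_or_GRle (S ∩ Set.Iic m) S' with h | h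
    · exfalso
      obtain ⟨p, hpS', hpS, hp⟩ := GRlt_iff.1 h
      have hpm : p ≤ m := hj ▸ le_mlen_of_mem_grChainSets hS' hpS'
      have hlt : GRlt S S' := by
        refine GRlt_iff.2 ⟨p, hpS', fun h => hpS ⟨h, hpm⟩, fun k hk => ?_⟩
        rw [← hp k hk]
        exact ⟨fun h => ⟨h, (hk.trans_le hpm).le⟩, fun h => h.1⟩
      have heq := (hmax S' (image_mem_grChainSets_of_submodule hS')).antisymm (Or.inr hlt)
      exact hlt.1 heq.symm
    · exact h
  have hex : ∃ T, T ∈ grChainSets Λ (c j) ∧ ∀ S' ∈ grChainSets Λ (c j), GRle S' T :=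
    ⟨_, hmem, hmax'⟩
  refine ⟨c j, hind j, ?_⟩
  rw [grMeasure, dif_pos hex]
  exact (hmax' _ hex.choose_spec.1).antisymm (hex.choose_spec.2 _ hmem)

end Length

theorem grMeasure_spec_of_nonempty {Λ M : Type*} [Ring Λ] [AddCommGroup M] [Module Λ M]
    (h : (grMeasure Λ M).Nonempty) :
    grMeasure Λ M ∈ grChainSets Λ M ∧ ∀ S ∈ grChainSets Λ M, GRle S (grMeasure Λ M) := by
  by_cases hex : ∃ S, S ∈ grChainSets Λ M ∧ ∀ S' ∈ grChainSets Λ M, GRle S' S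
  · rw [grMeasure, dif_pos hex]
    exact hex.choose_spec
  · rw [grMeasure, dif_neg hex] at h
    exact absurd h Set.not_nonempty_empty

theorem IsGRMeasureOf.finite {Λ : Type u} [Ring Λ] {I : Set ℕ} (h : IsGRMeasureOf Λ I) :
    I.Finite := by
  obtain ⟨M, _, _, -, -, rfl⟩ := h
  rcases (grMeasure Λ M).eq_empty_or_nonempty with h | h
  · rw [h]
    exact Set.finite_empty
  · obtain ⟨t, c, -, -, hc⟩ := (grMeasure_spec_of_nonempty h).1
    rw [hc]
    exact Set.finite_range _

theorem IsGRMeasureOf.inter_Iic {Λ : Type u} [Ring Λ] [IsArtinianRing Λ] {I : Set ℕ}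
    (h : IsGRMeasureOf Λ I) {m : ℕ} (hm : m ∈ I) : IsGRMeasureOf Λ (I ∩ Set.Iic m) := by
  obtain ⟨M, _, _, _, -, rfl⟩ := h
  obtain ⟨hmem, hmax⟩ := grMeasure_spec_of_nonempty ⟨m, hm⟩
  obtain ⟨A, hA, hAeq⟩ := exists_submodule_grMeasure_eq_inter_Iic hmem hmax hm
  exact ⟨A, inferInstance, inferInstance, inferInstance, hA, hAeq⟩

theorem exists_eq_of_GRlt_of_GRle {Λ : Type u} [Ring Λ] {μ : ℕ → Set ℕ}
    (hsucc : ∀ i, IsDirectSuccessor Λ (μ i) (μ (i + 1))) {K : Set ℕ} (hK : IsGRMeasureOf Λ K)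
    (h0 : GRlt (μ 0) K) (i : ℕ) (hi : GRle K (μ i)) : ∃ j, K = μ j := by
  induction i with
  | zero => exact ⟨0, hi.antisymm (Or.inr h0)⟩
  | succ i ih =>
    rcases hi with hi | hi
    · exact ⟨_, hi⟩
    · rcases GRlt_or_GRle (μ i) K with h | h
      · exact absurd ⟨K, hK, h, hi⟩ (hsucc i).2.2.2
      · exact ih h

/-- Let `Λ` be an artin algebra, `μ₀` a central GR measure for `Λ` (a GR
measure which is neither a take-off measure—infinitely many GR measures lie
below it—nor a landing measure—infinitely many GR measures lie above it), and
`μ₀ ≺ μ₁ ≺ μ₂ ≺ ⋯` a sequence of GR measures in which each `μ_{i+1}` is a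
direct successor of `μ_i`.  If the maximal element `|μ₀|` of `μ₀` satisfies
`|μ₀| ≤ |μ_i|` for all `i`, then every `μ_i` with `i ≥ 1` starts with `μ₀`.
(Here the maximal element of a GR measure, a finite nonempty set of positive
integers, is its supremum `sSup`.) -/
theorem startsWith_of_directSuccessor_seq (R : Type*) [CommRing R]
    [IsArtinianRing R] (Λ : Type u) [Ring Λ] [Algebra R Λ] [Module.Finite R Λ]
    (μ : ℕ → Set ℕ)
    (hμ0 : IsGRMeasureOf Λ (μ 0))
    (hnotTakeoff : {J | IsGRMeasureOf Λ J ∧ GRlt J (μ 0)}.Infinite)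
    (hnotLanding : {J | IsGRMeasureOf Λ J ∧ GRlt (μ 0) J}.Infinite)
    (hsucc : ∀ i, IsDirectSuccessor Λ (μ i) (μ (i + 1)))
    (hmin : ∀ i, sSup (μ 0) ≤ sSup (μ i)) :
    ∀ i, 1 ≤ i → GRstartsWith (μ i) (μ 0) := by
  have : IsArtinianRing Λ := IsArtinianRing.of_finite R Λ
  have hlt : ∀ i, 1 ≤ i → GRlt (μ 0) (μ i) := by
    intro i hi
    induction i, hi using Nat.le_induction with
    | base => exact (hsucc 0).2.2.1
    | succ i _ ih => exact ih.trans (hsucc i).2.2.1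
  have hμ : ∀ i, IsGRMeasureOf Λ (μ i) := fun i => (hsucc i).1
  intro i hi
  obtain ⟨m, hmi, hm0, hm⟩ := GRlt_iff.1 (hlt i hi)
  by_cases hall : ∀ a ∈ μ 0, a < m
  · refine Or.inr ⟨⟨fun a ha => (hm a (hall a ha)).1 ha, fun h => hm0 (h hmi)⟩, ?_⟩
    rintro a ha b ⟨hb, hb0⟩
    by_contra hba
    exact hb0 ((hm b (by have := hall a ha; omega)).2 hb)
  exfalso
  push Not at hall
  obtain ⟨a, ha, hma⟩ := hall
  have hlt_sup : m < sSup (μ 0) := by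
    have h1 := le_csSup hμ0.finite.bddAbove ha
    have h2 : m ≠ a := fun h => hm0 (h ▸ ha)
    omega
  have hKsup : sSup (μ i ∩ Set.Iic m) = m :=
    IsGreatest.csSup_eq ⟨⟨hmi, Set.mem_Iic.2 le_rfl⟩, fun k hk => hk.2⟩
  have h0K : GRlt (μ 0) (μ i ∩ Set.Iic m) := by
    refine GRlt_iff.2 ⟨m, ⟨hmi, Set.mem_Iic.2 le_rfl⟩, hm0, fun k hk => ?_⟩
    rw [hm k hk]
    exact ⟨fun h => ⟨h, hk.le⟩, fun h => h.1⟩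
  have hKi : GRle (μ i ∩ Set.Iic m) (μ i) := by
    rcases GRlt_or_GRle (μ i) (μ i ∩ Set.Iic m) with h | h
    · obtain ⟨p, hp, hpi, -⟩ := GRlt_iff.1 h
      exact absurd hp.1 hpi
    · exact h
  obtain ⟨j, hj⟩ := exists_eq_of_GRlt_of_GRle hsucc ((hμ i).inter_Iic hmi) h0K i hKi
  have := hmin j
  rw [← hj, hKsup] at this
  omega
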